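/- Let (Σ_M, σ) be an irreducible topological Markov chain with ultrametric d_λ, λ > 1, Q a periodic orbit, and G^s(Q) the stable groupoid. Let Φ^{−1} : G^s(Q) → G^s(Q) be given by Φ^{−1}(x,y) = (σ^{−1}(x), σ^{−1}(y)). Then for every a ∈ G^s(Q): if c_s(a) ≥ 1 then c_s(Φ^{−1}(a)) = c_s(a) + 1, while if c_s(a) = 0 then c_s(Φ^{−1}(a)) ≤ 1. Consequently, Φ^{−1}(c_s^{−1}(N)) = c_s^{−1}(N+1) for every integer N ≥ 1. -/

import Mathlib

open scoped Classical

/-- A sequence `x : ℤ → Fin m` is allowable for the 0-1 matrix `M` if all its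
transitions are allowed. -/
def IsMarkov {m : ℕ} (M : Fin m → Fin m → Bool) (x : ℤ → Fin m) : Prop :=
  ∀ i : ℤ, M (x i) (x (i + 1)) = true

/-- The topological Markov chain `Σ_M` of allowable bi-infinite sequences. -/
def TMC {m : ℕ} (M : Fin m → Fin m → Bool) : Type := {x : ℤ → Fin m // IsMarkov M x}

namespace TMC

variable {m : ℕ} {M : Fin m → Fin m → Bool}

instance : TopologicalSpace (TMC M) :=
  inferInstanceAs (TopologicalSpace {x : ℤ → Fin m // IsMarkov M x})

/-- The shift homeomorphism `σ(x)_i = x_{i+1}`. -/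
def shift (M : Fin m → Fin m → Bool) (x : TMC M) : TMC M :=
  ⟨fun i => x.1 (i + 1), fun i => x.2 (i + 1)⟩

/-- The inverse shift `σ⁻¹(x)_i = x_{i-1}`. -/
def shiftInv (M : Fin m → Fin m → Bool) (x : TMC M) : TMC M :=
  ⟨fun i => x.1 (i - 1), fun i => by
    have h : i + 1 - 1 = i - 1 + 1 := by ring
    show M (x.1 (i - 1)) (x.1 (i + 1 - 1)) = true
    rw [h]
    exact x.2 (i - 1)⟩

/-- The ultrametric `d_λ(x,y) = inf{λ^{-n} : n ≥ 0, xᵢ = yᵢ for |i| < n}`. -/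
noncomputable def dlam (lam : ℝ) (x y : TMC M) : ℝ :=
  sInf {r : ℝ | ∃ n : ℕ, (∀ i : ℤ, |i| < (n : ℤ) → x.1 i = y.1 i) ∧ r = lam ^ (-(n : ℤ))}

/-- The bracket (splicing) map: `[x,y]_n = y_n` for `n ≤ 0` and `[x,y]_n = x_n` for
`n ≥ 1`, defined when `x₀ = y₀` (junk value `x` otherwise). -/
noncomputable def bracket (x y : TMC M) : TMC M :=
  if h : x.1 0 = y.1 0 then
    ⟨fun n => if n ≤ 0 then y.1 n else x.1 n, by
      intro i
      by_cases h1 : i + 1 ≤ 0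
      · have h2 : i ≤ 0 := by omega
        simp only [if_pos h1, if_pos h2]
        exact y.2 i
      · by_cases h2 : i ≤ 0
        · have h3 : i = 0 := by omega
          subst h3
          simp only [if_neg h1, le_refl, if_pos]
          rw [← h]
          exact x.2 0
        · simp only [if_neg h1, if_neg h2]
          exact x.2 i⟩
  else x

/-- The local stable set `X^s(x,ε) = {y : d_λ(x,y) < ε, [x,y] = y}`. -/
def locStable (lam : ℝ) (x : TMC M) (ε : ℝ) : Set (TMC M) :=
  {y | dlam lam x y < ε ∧ bracket x y = y}

/-- The local unstable set `X^u(x,ε) = {y : d_λ(x,y) < ε, [y,x] = y}`. -/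
def locUnstable (lam : ℝ) (x : TMC M) (ε : ℝ) : Set (TMC M) :=
  {y | dlam lam x y < ε ∧ bracket y x = y}

/-- The global stable set `X^s(x) = {y : d_λ(σⁿx, σⁿy) → 0 as n → +∞}`. -/
def globStable (lam : ℝ) (x : TMC M) : Set (TMC M) :=
  {y | Filter.Tendsto (fun n : ℕ => dlam lam ((shift M)^[n] x) ((shift M)^[n] y))
        Filter.atTop (nhds 0)}

/-- The global unstable set `X^u(x) = {y : d_λ(σⁿx, σⁿy) → 0 as n → −∞}`. -/
def globUnstable (lam : ℝ) (x : TMC M) : Set (TMC M) :=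
  {y | Filter.Tendsto (fun n : ℕ => dlam lam ((shiftInv M)^[n] x) ((shiftInv M)^[n] y))
        Filter.atTop (nhds 0)}

/-- The (forward) `σ`-orbit of a point. -/
def orbit (q : TMC M) : Set (TMC M) := {y | ∃ k : ℕ, (shift M)^[k] q = y}

/-- `X^u(Q) = ∪_{q' ∈ Q} X^u(q')` for `Q` the orbit of `q`. -/
def XuQ (lam : ℝ) (q : TMC M) : Set (TMC M) := ⋃ q' ∈ orbit q, globUnstable lam q'

/-- The stable groupoid `G^s(Q) = {(x,y) : x,y ∈ X^u(Q), y ∈ X^s(x)}`. -/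
def GsQ (lam : ℝ) (q : TMC M) : Set (TMC M × TMC M) :=
  {a | a.1 ∈ XuQ lam q ∧ a.2 ∈ XuQ lam q ∧ a.2 ∈ globStable lam a.1}

/-- `c_s(a)`: the least `N ≥ 0` with `σ^N(a₂) ∈ X^s(σ^N(a₁), λ⁻¹)`. -/
noncomputable def cs (lam : ℝ) (a : TMC M × TMC M) : ℕ :=
  sInf {N : ℕ | (shift M)^[N] a.2 ∈ locStable lam ((shift M)^[N] a.1) lam⁻¹}

/-- The stable holonomy map `h^s(z) = σ^{-N}[σ^N(z), σ^N(c₁)]`. -/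
noncomputable def holS (N : ℕ) (c₁ z : TMC M) : TMC M :=
  (shiftInv M)^[N] (bracket ((shift M)^[N] z) ((shift M)^[N] c₁))

/-- The base set `V^s(c, η, N) = {(h^s(z), z) : z ∈ X^u(c₂, η)}`. -/
def Vs (lam : ℝ) (c : TMC M × TMC M) (η : ℝ) (N : ℕ) : Set (TMC M × TMC M) :=
  {b | b.2 ∈ locUnstable lam c.2 η ∧ b.1 = holS N c.1 b.2}

/-- `d_{s,λ}` on the stable groupoid. -/
noncomputable def dsl (lam : ℝ) (a b : TMC M × TMC M) : ℝ :=
  if b.2 ∈ locUnstable lam a.2 lam⁻¹ ∧ b.1 ∈ locUnstable lam a.1 lam⁻¹ then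
    max (dlam lam a.1 b.1) (dlam lam a.2 b.2)
  else 1

/-- The groupoid ultrametric `D_{s,λ}`. -/
noncomputable def Dsl (lam : ℝ) (a b : TMC M × TMC M) : ℝ :=
  if cs lam a = cs lam b then dsl lam a b else 1

/-- The induced metric `D̃_{s,λ}` on the unit space `X^u(Q)`. -/
noncomputable def DslUnits (lam : ℝ) (x y : TMC M) : ℝ :=
  if y ∈ locUnstable lam x lam⁻¹ then dlam lam x y else 1

end TMC

namespace TMC

variable {m : ℕ} {M : Fin m → Fin m → Bool}

theorem shift_shiftInv (x : TMC M) : shift M (shiftInv M x) = x := by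
  apply Subtype.ext
  funext i
  simp [shift, shiftInv]

theorem shiftInv_shift (x : TMC M) : shiftInv M (shift M x) = x := by
  apply Subtype.ext
  funext i
  simp [shift, shiftInv]

theorem shift_iterate_apply (N : ℕ) (x : TMC M) (i : ℤ) :
    ((shift M)^[N] x).1 i = x.1 (i + N) := by
  induction N generalizing x with
  | zero => simp
  | succ N ih =>
    rw [Function.iterate_succ_apply, ih]
    simp only [shift, Nat.cast_succ, add_assoc]

theorem agree_of_dlam_lt {lam : ℝ} (hlam : 1 < lam) {x y : TMC M}
    (h : dlam lam x y < lam⁻¹) : ∀ i : ℤ, |i| < 2 → x.1 i = y.1 i := by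
  rw [dlam] at h
  obtain ⟨r, ⟨n, hn, rfl⟩, hr⟩ := exists_lt_of_csInf_lt
    (Set.nonempty_of_mem (x := 1) (by exact ⟨0, fun i hi => absurd hi (by simp), by simp⟩)) h
  rw [← zpow_neg_one, zpow_lt_zpow_iff_right₀ hlam] at hr
  exact fun i hi => hn i (by omega)

theorem dlam_lt_of_agree {lam : ℝ} (hlam : 1 < lam) {x y : TMC M}
    (h : ∀ i : ℤ, |i| < 2 → x.1 i = y.1 i) : dlam lam x y < lam⁻¹ := by
  rw [dlam]
  refine (csInf_le ⟨0, ?_⟩ (by exact ⟨2, h, rfl⟩)).trans_lt ?_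
  · rintro r ⟨n, -, rfl⟩
    positivity
  · rw [← zpow_neg_one, zpow_lt_zpow_iff_right₀ hlam]
    norm_num

theorem bracket_eq_right_iff {x y : TMC M} (h0 : x.1 0 = y.1 0) :
    bracket x y = y ↔ ∀ i : ℤ, 1 ≤ i → x.1 i = y.1 i := by
  have hb : bracket x y = _ := dif_pos h0
  rw [hb]
  constructor
  · intro h i hi
    have h' := congrFun (congrArg Subtype.val h) i
    simpa [show ¬ i ≤ 0 by omega] using h'
  · intro h
    apply Subtype.ext
    funext i
    by_cases hi : i ≤ 0
    · simp [hi]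
    · simpa [hi] using h i (by omega)

theorem mem_locStable_inv_iff {lam : ℝ} (hlam : 1 < lam) {x y : TMC M} :
    y ∈ locStable lam x lam⁻¹ ↔ ∀ i : ℤ, -1 ≤ i → x.1 i = y.1 i := by
  constructor
  · rintro ⟨hd, hb⟩ i hi
    have ha := agree_of_dlam_lt hlam hd
    rcases le_or_gt 1 i with h | h
    · exact (bracket_eq_right_iff (ha 0 (by norm_num))).1 hb i h
    · exact ha i (abs_lt.2 (by omega))
  · intro h
    exact ⟨dlam_lt_of_agree hlam fun i hi => h i (by rw [abs_lt] at hi; omega),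
      (bracket_eq_right_iff (h 0 (by norm_num))).2 fun i hi => h i (by omega)⟩

theorem cs_eq_sInf_agree {lam : ℝ} (hlam : 1 < lam) (a : TMC M × TMC M) :
    cs lam a = sInf {N : ℕ | ∀ i : ℤ, (N : ℤ) - 1 ≤ i → a.1.1 i = a.2.1 i} := by
  unfold cs
  congr 1
  ext N
  simp only [Set.mem_ofPred_eq, mem_locStable_inv_iff hlam, shift_iterate_apply]
  constructor
  · intro h i hi
    simpa using h (i - N) (by omega)
  · exact fun h i hi => h _ (by omega)

theorem cs_shiftInv_eq_sInf_agree {lam : ℝ} (hlam : 1 < lam) (a : TMC M × TMC M) :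
    cs lam (shiftInv M a.1, shiftInv M a.2) =
      sInf {N : ℕ | ∀ i : ℤ, (N : ℤ) - 2 ≤ i → a.1.1 i = a.2.1 i} := by
  rw [cs_eq_sInf_agree hlam]
  congr 1
  ext N
  simp only [Set.mem_ofPred_eq, shiftInv]
  constructor
  · intro h i hi
    simpa using h (i + 1) (by omega)
  · exact fun h i hi => h _ (by omega)

theorem cs_shiftInv_of_one_le {lam : ℝ} (hlam : 1 < lam) (a : TMC M × TMC M)
    (h : 1 ≤ cs lam a) : cs lam (shiftInv M a.1, shiftInv M a.2) = cs lam a + 1 := by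
  rw [cs_shiftInv_eq_sInf_agree hlam]
  rw [cs_eq_sInf_agree hlam] at h ⊢
  have hmem := Nat.sInf_mem (Nat.nonempty_of_pos_sInf h)
  have hmem' : sInf {N : ℕ | ∀ i : ℤ, (N : ℤ) - 1 ≤ i → a.1.1 i = a.2.1 i} + 1 ∈
      {N : ℕ | ∀ i : ℤ, (N : ℤ) - 2 ≤ i → a.1.1 i = a.2.1 i} :=
    fun i hi => hmem i (by push_cast at hi; omega)
  refine le_antisymm (Nat.sInf_le hmem') (le_csInf ⟨_, hmem'⟩ fun K hK => ?_)
  have hle := Nat.sInf_le (s := {N : ℕ | ∀ i : ℤ, (N : ℤ) - 1 ≤ i → a.1.1 i = a.2.1 i})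
    (m := K - 1) fun i hi => hK i (by omega)
  omega

theorem cs_shiftInv_le_one {lam : ℝ} (hlam : 1 < lam) (a : TMC M × TMC M)
    (h : cs lam a = 0) : cs lam (shiftInv M a.1, shiftInv M a.2) ≤ 1 := by
  rw [cs_shiftInv_eq_sInf_agree hlam]
  rw [cs_eq_sInf_agree hlam] at h
  rcases Nat.sInf_eq_zero.1 h with h0 | h0
  · exact Nat.sInf_le fun i hi => h0 i (by push_cast at hi ⊢; omega)
  · by_contra! hlt
    obtain ⟨K, hK⟩ := Nat.nonempty_of_pos_sInf (zero_lt_one.trans hlt)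
    exact Set.eq_empty_iff_forall_notMem.1 h0 K fun i hi => hK i (by omega)

theorem shift_mem_globStable_iff (lam : ℝ) (x y : TMC M) :
    shift M y ∈ globStable lam (shift M x) ↔ y ∈ globStable lam x := by
  simp only [globStable, Set.mem_ofPred_eq, ← Function.iterate_succ_apply]
  exact Filter.tendsto_add_atTop_iff_nat
    (f := fun n : ℕ => dlam lam ((shift M)^[n] x) ((shift M)^[n] y)) 1

theorem shiftInv_mem_globUnstable_iff (lam : ℝ) (x y : TMC M) :
    shiftInv M y ∈ globUnstable lam (shiftInv M x) ↔ y ∈ globUnstable lam x := by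
  simp only [globUnstable, Set.mem_ofPred_eq, ← Function.iterate_succ_apply]
  exact Filter.tendsto_add_atTop_iff_nat
    (f := fun n : ℕ => dlam lam ((shiftInv M)^[n] x) ((shiftInv M)^[n] y)) 1

theorem shift_mem_orbit {q x : TMC M} (hx : x ∈ orbit q) : shift M x ∈ orbit q := by
  obtain ⟨k, rfl⟩ := hx
  exact ⟨k + 1, Function.iterate_succ_apply' _ _ _⟩

theorem shiftInv_mem_orbit {q x : TMC M} (hq : ∃ n : ℕ, 1 ≤ n ∧ (shift M)^[n] q = q)
    (hx : x ∈ orbit q) : shiftInv M x ∈ orbit q := by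
  obtain ⟨k, rfl⟩ := hx
  obtain ⟨n, hn, hnq⟩ := hq
  refine ⟨k + n - 1, ?_⟩
  rw [← shiftInv_shift ((shift M)^[k + n - 1] q), ← Function.iterate_succ_apply' (shift M),
    show (k + n - 1).succ = k + n by omega, Function.iterate_add_apply, hnq]

theorem shiftInv_mem_XuQ_iff (lam : ℝ) {q : TMC M}
    (hq : ∃ n : ℕ, 1 ≤ n ∧ (shift M)^[n] q = q) (x : TMC M) :
    shiftInv M x ∈ XuQ lam q ↔ x ∈ XuQ lam q := by
  simp only [XuQ, Set.mem_iUnion, exists_prop]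
  constructor
  · rintro ⟨p, hp, hx⟩
    refine ⟨shift M p, shift_mem_orbit hp, ?_⟩
    rwa [← shiftInv_mem_globUnstable_iff, shiftInv_shift]
  · rintro ⟨p, hp, hx⟩
    exact ⟨shiftInv M p, shiftInv_mem_orbit hq hp, (shiftInv_mem_globUnstable_iff _ _ _).2 hx⟩

theorem shiftInv_mem_GsQ_iff (lam : ℝ) {q : TMC M}
    (hq : ∃ n : ℕ, 1 ≤ n ∧ (shift M)^[n] q = q) (a : TMC M × TMC M) :
    (shiftInv M a.1, shiftInv M a.2) ∈ GsQ lam q ↔ a ∈ GsQ lam q := by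
  simp only [GsQ, Set.mem_ofPred_eq, shiftInv_mem_XuQ_iff lam hq,
    ← shift_mem_globStable_iff lam (shiftInv M a.1), shift_shiftInv]

end TMC

open TMC in
/-- In an irreducible topological Markov chain with stable groupoid
`G^s(Q)` and `Φ⁻¹(x,y) = (σ⁻¹x, σ⁻¹y)`: if `c_s(a) ≥ 1` then `c_s(Φ⁻¹a) = c_s(a) + 1`,
while if `c_s(a) = 0` then `c_s(Φ⁻¹a) ≤ 1`; consequently
`Φ⁻¹(c_s^{-1}(N)) = c_s^{-1}(N+1)` for every `N ≥ 1`. -/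
theorem tmc_cs_shift {m : ℕ} (hm : 1 ≤ m) (M : Fin m → Fin m → Bool)
    (lam : ℝ) (hlam : 1 < lam)
    (hirr : ∀ U V : Set (TMC M), IsOpen U → IsOpen V → U.Nonempty → V.Nonempty →
      ∃ n : ℕ, ((shift M)^[n] '' U ∩ V).Nonempty)
    (q : TMC M) (hq : ∃ n : ℕ, 1 ≤ n ∧ (shift M)^[n] q = q) :
    (∀ a ∈ GsQ lam q,
      (1 ≤ cs lam a → cs lam (shiftInv M a.1, shiftInv M a.2) = cs lam a + 1) ∧
      (cs lam a = 0 → cs lam (shiftInv M a.1, shiftInv M a.2) ≤ 1)) ∧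
    (∀ N : ℕ, 1 ≤ N →
      (fun a : TMC M × TMC M => (shiftInv M a.1, shiftInv M a.2)) ''
          {a | a ∈ GsQ lam q ∧ cs lam a = N}
        = {b | b ∈ GsQ lam q ∧ cs lam b = N + 1}) := by
  refine ⟨fun a _ => ⟨cs_shiftInv_of_one_le hlam a, cs_shiftInv_le_one hlam a⟩, fun N hN => ?_⟩
  ext b
  constructor
  · rintro ⟨a, ⟨ha, rfl⟩, rfl⟩
    exact ⟨(shiftInv_mem_GsQ_iff lam hq a).2 ha, cs_shiftInv_of_one_le hlam a hN⟩
  · rintro ⟨hb, hbN⟩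
    have hba : (shiftInv M (shift M b.1), shiftInv M (shift M b.2)) = b := by
      simp only [shiftInv_shift]
    refine ⟨(shift M b.1, shift M b.2), ⟨?_, ?_⟩, hba⟩
    · rw [← shiftInv_mem_GsQ_iff lam hq]
      rwa [hba]
    · have h1 := cs_shiftInv_of_one_le hlam (shift M b.1, shift M b.2)
      have h0 := cs_shiftInv_le_one hlam (shift M b.1, shift M b.2)
      simp only [hba] at h1 h0
      omega
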